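/- For all positive integers n and M define p(n, M) := |{ w ∈ {1, 2, …, M}^n : there are no w-bubbles }| / M^n. Then for every positive integer n, the limit of p(n, M) as M → ∞ equals 1. -/

import Mathlib

/-- The weighted dot product `w · u = ∑ i, w i * u i`. -/
def dotW {n : ℕ} (w u : Fin n → ℕ) : ℕ := ∑ i, w i * u i

/-- `d_w`, the least common multiple of the weights. -/
def lcmW {n : ℕ} (w : Fin n → ℕ) : ℕ := Finset.univ.lcm w

/-- `u` is a `w`-bubble: `w · u ≥ 2 d_w` and there is no `v ⪯ u` with `w · v = d_w`. -/
def IsBubble {n : ℕ} (w u : Fin n → ℕ) : Prop :=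
  2 * lcmW w ≤ dotW w u ∧
    ¬ ∃ v : Fin n → ℕ, (∀ i, v i ≤ u i) ∧ dotW w v = lcmW w

open scoped Classical

/-- `p(n, M)`: the proportion of weight vectors in `{1, …, M}^n` admitting no bubble. -/
noncomputable def pNoBubble (n M : ℕ) : ℝ :=
  ((Finset.filter (fun w : Fin n → ℕ => ¬ ∃ u : Fin n → ℕ, IsBubble w u)
      (Fintype.piFinset fun _ : Fin n => Finset.Icc 1 M)).card : ℝ) / (M : ℝ) ^ n

lemma two_elem (a b p q T M : ℕ) (ha : 0 < a) (hb : 0 < b) (haM : a ≤ M) (hbM : b ≤ M)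
    (hg : Nat.gcd a b ∣ T) (hp : 2 * M ^ 2 ≤ a * p) (hq : 2 * M ^ 2 ≤ b * q)
    (hT : 2 * M ^ 2 ≤ T) (hT2 : T + 2 * M ^ 2 ≤ a * p + b * q) :
    ∃ x y, x ≤ p ∧ y ≤ q ∧ a * x + b * y = T := by
  obtain ⟨t, rfl⟩ := hg
  set T := Nat.gcd a b * t with hTdef
  have hbez := Nat.gcd_eq_gcd_ab a b
  set x0 : ℕ := (T - b * q) / a + 1 with hx0
  set z : ℤ := Nat.gcdA a b * t with hz
  set r : ℤ := (z - x0) % b with hr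
  have hr0 : 0 ≤ r := Int.emod_nonneg _ (by omega)
  have hr1 : r < b := Int.emod_lt_of_pos _ (by omega)
  obtain ⟨r', hr'⟩ := Int.eq_ofNat_of_zero_le hr0
  have hrb : r' < b := by omega
  have hdm := Nat.div_add_mod (T - b * q) a
  have hml := Nat.mod_lt (T - b * q) ha
  have hax0 : a * x0 ≤ (T - b * q) + a := by
    rw [hx0, mul_add, mul_one]; omega
  have hax0' : T - b * q ≤ a * x0 := by
    rw [hx0, mul_add, mul_one]; omega
  have haa : a ≤ M ^ 2 := by nlinarith
  have hab : a * r' ≤ M ^ 2 := by nlinarith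
  have hax : a * (x0 + r') ≤ (T - b * q) + 2 * M ^ 2 := by nlinarith
  have hax' : T - b * q ≤ a * (x0 + r') := by nlinarith
  have h1 : a * (x0 + r') ≤ T := by omega
  have h2 : a * (x0 + r') ≤ a * p := by omega
  have hdvd : (b : ℤ) ∣ (T : ℤ) - a * (x0 + r') := by
    have h3 : (b : ℤ) ∣ (z - x0) - r := by
      rw [hr]; exact Int.dvd_self_sub_emod
    obtain ⟨c, hc⟩ := h3
    refine ⟨Nat.gcdB a b * t + a * c, ?_⟩
    have : (T : ℤ) = (a * Nat.gcdA a b + b * Nat.gcdB a b) * t := by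
      rw [hTdef]; push_cast; rw [hbez]
    rw [this]
    have h4 : (r' : ℤ) = z - x0 - b * c := by
      rw [← hc, hr']; ring
    rw [h4, hz]; ring
  have hdvd' : b ∣ T - a * (x0 + r') := by
    have := hdvd
    rw [← Int.natCast_dvd_natCast, Nat.cast_sub h1]
    push_cast; exact this
  obtain ⟨y, hy⟩ := hdvd'
  refine ⟨x0 + r', y, Nat.le_of_mul_le_mul_left h2 ha, ?_, by omega⟩
  apply Nat.le_of_mul_le_mul_left _ hb
  omega

lemma lt_of_bubble {n : ℕ} {w u : Fin n → ℕ} (h : IsBubble w u) (i : Fin n) :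
    w i * u i < lcmW w := by
  by_contra hc
  push Not at hc
  apply h.2
  have hd : w i ∣ lcmW w := Finset.dvd_lcm (Finset.mem_univ i)
  obtain ⟨c, hcc⟩ := hd
  refine ⟨Pi.single i (if w i = 0 then 0 else c), ?_, ?_⟩
  · intro k
    by_cases hk : k = i
    · subst hk
      simp only [Pi.single_eq_same]
      split_ifs with h0
      · exact Nat.zero_le _
      · rw [hcc] at hc
        exact Nat.le_of_mul_le_mul_left hc (Nat.pos_of_ne_zero h0)
    · simp [Pi.single_eq_of_ne hk]
  · unfold dotW
    rw [Finset.sum_eq_single i]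
    · simp only [Pi.single_eq_same]
      split_ifs with h0
      · rw [hcc, h0]; simp
      · exact hcc.symm
    · intro k _ hk
      simp [Pi.single_eq_of_ne hk]
    · simp

lemma no_bubble_small {n : ℕ} (hn : 0 < n) (hn2 : n ≤ 2) (w u : Fin n → ℕ) : ¬ IsBubble w u := by
  intro h
  have h1 := h.1
  have : dotW w u < n * lcmW w := by
    unfold dotW
    calc ∑ i, w i * u i < ∑ _i : Fin n, lcmW w :=
          Finset.sum_lt_sum_of_nonempty ⟨⟨0, hn⟩, Finset.mem_univ _⟩ (fun i _ => lt_of_bubble h i)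
      _ = _ := by simp
  nlinarith

lemma dotW_add {n : ℕ} (w u v : Fin n → ℕ) : dotW w (u + v) = dotW w u + dotW w v := by
  simp [dotW, mul_add, Finset.sum_add_distrib]

lemma dotW_single {n : ℕ} (w : Fin n → ℕ) (i : Fin n) (x : ℕ) :
    dotW w (Pi.single i x) = w i * x := by
  unfold dotW
  rw [Finset.sum_eq_single i] <;> simp +contextual [Pi.single_apply]

lemma no_bubble_large {n : ℕ} (hn : 0 < n) (w u : Fin n → ℕ) (M : ℕ)
    (hw : ∀ i, 0 < w i ∧ w i ≤ M) (hd : 5 * n * M ^ 2 ≤ lcmW w) : ¬ IsBubble w u := by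
  intro h
  have hlt := lt_of_bubble h
  have h2d := h.1
  have hnev := h.2
  set d := lcmW w with hdd
  have hM : 0 < M := (hw ⟨0, hn⟩).1.trans_le (hw ⟨0, hn⟩).2
  have hM2 : 0 < M ^ 2 := by positivity
  have hdpos : 0 < d := lt_of_lt_of_le (by positivity) hd
  -- first index
  obtain ⟨i, hi⟩ : ∃ i, d ≤ n * (w i * u i) := by
    by_contra hc
    push Not at hc
    have : ∑ k, n * (w k * u k) < ∑ _k : Fin n, d :=
      Finset.sum_lt_sum_of_nonempty ⟨⟨0, hn⟩, Finset.mem_univ _⟩ (fun k _ => hc k)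
    rw [← Finset.mul_sum] at this
    simp only [Finset.sum_const, Finset.card_univ, Fintype.card_fin, smul_eq_mul] at this
    have := Nat.lt_of_mul_lt_mul_left this
    unfold dotW at h2d
    omega
  have hsplit : dotW w u = w i * u i + ∑ k ∈ Finset.univ.erase i, w k * u k :=
    (Finset.add_sum_erase _ _ (Finset.mem_univ i)).symm
  obtain ⟨j, hj, hju⟩ : ∃ j ∈ Finset.univ.erase i, d ≤ n * (w j * u j) := by
    by_contra hc
    push Not at hc
    have h1 : ∑ k ∈ Finset.univ.erase i, n * (w k * u k) ≤ ∑ _k ∈ Finset.univ.erase i, d :=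
      Finset.sum_le_sum (fun k hk => (hc k hk).le)
    rw [← Finset.mul_sum] at h1
    simp only [Finset.sum_const, smul_eq_mul] at h1
    have h3 : (Finset.univ.erase i).card ≤ n := by
      simpa using Finset.card_le_univ (Finset.univ.erase i)
    have h4 : n * ∑ k ∈ Finset.univ.erase i, w k * u k ≤ n * d :=
      h1.trans (Nat.mul_le_mul_right _ h3)
    have h5 := Nat.le_of_mul_le_mul_left h4 hn
    have := hlt i
    omega
  have hij : j ≠ i := Finset.ne_of_mem_erase hj
  have hbi : 5 * M ^ 2 ≤ w i * u i := by
    apply Nat.le_of_mul_le_mul_left _ hn; nlinarith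
  have hbj : 5 * M ^ 2 ≤ w j * u j := by
    apply Nat.le_of_mul_le_mul_left _ hn; nlinarith
  set g := Nat.gcd (w i) (w j) with hg
  have hgM : g ≤ M := (Nat.gcd_le_left _ (hw i).1).trans (hw i).2
  have hgw : ∀ k, w k * g ≤ M ^ 2 := fun k => by
    rw [pow_two]; exact Nat.mul_le_mul (hw k).2 hgM
  -- maximal choice
  let P : ℕ → Prop := fun R => ∃ v : Fin n → ℕ, (∀ k, v k ≤ u k) ∧ v i = 0 ∧ v j = 0 ∧
    (∀ k, g ∣ v k) ∧ dotW w v = R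
  have hdM : 5 * M ^ 2 ≤ d := by nlinarith
  have hP0 : P 0 := ⟨0, by simp, rfl, rfl, by simp, by simp [dotW]⟩
  have hPR := Nat.findGreatest_spec (P := P) (Nat.zero_le (d - 2 * M ^ 2)) hP0
  have hRle := Nat.findGreatest_le (P := P) (d - 2 * M ^ 2)
  have hmax : ∀ k, Nat.findGreatest P (d - 2 * M ^ 2) < k → k ≤ d - 2 * M ^ 2 → ¬ P k :=
    fun k h1 h2 => Nat.findGreatest_is_greatest h1 h2
  generalize Nat.findGreatest P (d - 2 * M ^ 2) = R at hPR hRle hmax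
  obtain ⟨v, hvu, hvi, hvj, hgv, hvR⟩ := hPR
  have hsplit2 : ∀ f : Fin n → ℕ, dotW w f = w i * f i + (w j * f j +
      ∑ k ∈ (Finset.univ.erase i).erase j, w k * f k) := fun f => by
    rw [Finset.add_sum_erase (Finset.univ.erase i) (fun k => w k * f k) hj,
      Finset.add_sum_erase _ (fun k => w k * f k) (Finset.mem_univ i)]; rfl
  have hkey : d - R + 2 * M ^ 2 ≤ w i * u i + w j * u j := by
    by_contra hc
    push Not at hc
    have hstep : ∀ k ∈ (Finset.univ.erase i).erase j, w k * u k ≤ w k * v k + M ^ 2 := by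
      intro k hk
      have hkj : k ≠ j := Finset.ne_of_mem_erase hk
      have hki : k ≠ i := Finset.ne_of_mem_erase (Finset.mem_of_mem_erase hk)
      have hlt : u k < v k + g := by
        by_contra hcc
        push Not at hcc
        have hgpos : 0 < g := Nat.gcd_pos_of_pos_left _ (hw i).1
        have hp : 0 < w k * g := Nat.mul_pos (hw k).1 hgpos
        have := hgw k
        refine hmax (R + w k * g) (by omega) (by omega) ⟨v + Pi.single k g, ?_, ?_, ?_, ?_, ?_⟩
        · intro l
          by_cases hl : l = k
          · subst hl; simpa using hcc
          · simpa [Pi.single_eq_of_ne hl] using hvu l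
        · simp [hvi, Pi.single_eq_of_ne hki.symm]
        · simp [hvj, Pi.single_eq_of_ne hkj.symm]
        · intro l
          by_cases hl : l = k
          · subst hl; simpa using hgv l
          · simpa [Pi.single_eq_of_ne hl] using hgv l
        · rw [dotW_add, dotW_single, hvR]
      have := hgw k
      calc w k * u k ≤ w k * (v k + g) := Nat.mul_le_mul_left _ hlt.le
        _ = w k * v k + w k * g := by ring
        _ ≤ _ := by omega
    have hsum := Finset.sum_le_sum hstep
    rw [Finset.sum_add_distrib, Finset.sum_const, smul_eq_mul] at hsum
    have hcard : ((Finset.univ.erase i).erase j).card ≤ n := by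
      simpa using Finset.card_le_univ ((Finset.univ.erase i).erase j)
    have hcm := Nat.mul_le_mul_right (M ^ 2) hcard
    have e1 := hsplit2 u
    have e2 := hsplit2 v
    rw [hvi, hvj] at e2
    have : d < n * M ^ 2 + 2 * M ^ 2 := by omega
    nlinarith
  have hgT : g ∣ d - R := by
    apply Nat.dvd_sub
    · exact (Nat.gcd_dvd_left _ _).trans (Finset.dvd_lcm (Finset.mem_univ i))
    · rw [← hvR]
      exact Finset.dvd_sum fun k _ => (hgv k).mul_left _
  obtain ⟨x, y, hx, hy, hxy⟩ := two_elem (w i) (w j) (u i) (u j) (d - R) M (hw i).1 (hw j).1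
    (hw i).2 (hw j).2 hgT (by omega) (by omega) (by omega) hkey
  refine hnev ⟨v + Pi.single i x + Pi.single j y, ?_, ?_⟩
  · intro k
    by_cases hki : k = i
    · subst hki; simpa [hvi, Pi.single_eq_of_ne hij.symm] using hx
    · by_cases hkj : k = j
      · subst hkj; simpa [hvj, Pi.single_eq_of_ne hij] using hy
      · simpa [Pi.single_eq_of_ne hki, Pi.single_eq_of_ne hkj] using hvu k
  · rw [dotW_add, dotW_add, dotW_single, dotW_single, hvR]
    omega

lemma lcm_three {n : ℕ} (w : Fin n → ℕ) (hw : ∀ i, 0 < w i) (i j k : Fin n) (M K : ℕ)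
    (hi : M ≤ w i * K) (hj : M ≤ w j * K) (hk : M ≤ w k * K)
    (hij : Nat.gcd (w i) (w j) ≤ K) (hik : Nat.gcd (w i) (w k) ≤ K)
    (hjk : Nat.gcd (w j) (w k) ≤ K) : M ^ 3 ≤ K ^ 6 * lcmW w := by
  have hdvd : Nat.lcm (Nat.lcm (w i) (w j)) (w k) ∣ lcmW w :=
    Nat.lcm_dvd (Nat.lcm_dvd (Finset.dvd_lcm (Finset.mem_univ i))
      (Finset.dvd_lcm (Finset.mem_univ j))) (Finset.dvd_lcm (Finset.mem_univ k))
  have hpos : 0 < lcmW w := Nat.pos_of_ne_zero (by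
    unfold lcmW
    rw [Ne, Finset.lcm_eq_zero_iff]
    rintro ⟨l, _, hl⟩
    exact (hw l).ne' hl)
  have hle := Nat.le_of_dvd hpos hdvd
  have h1 := Nat.gcd_mul_lcm (w i) (w j)
  have h2 := Nat.gcd_mul_lcm (Nat.lcm (w i) (w j)) (w k)
  have h3 : Nat.gcd (Nat.lcm (w i) (w j)) (w k) ≤ K * K := by
    have hd1 : Nat.gcd (Nat.lcm (w i) (w j)) (w k) ∣ Nat.gcd (w k) (w i * w j) := by
      rw [Nat.gcd_comm]
      exact Nat.gcd_dvd_gcd_of_dvd_right _ (Nat.lcm_dvd_mul _ _)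
    have hd2 := hd1.trans (Nat.gcd_mul_right_dvd_mul_gcd (w k) (w i) (w j))
    have := Nat.le_of_dvd (Nat.mul_pos (Nat.gcd_pos_of_pos_left _ (hw k))
      (Nat.gcd_pos_of_pos_left _ (hw k))) hd2
    refine this.trans (Nat.mul_le_mul ?_ ?_)
    · rwa [Nat.gcd_comm]
    · rwa [Nat.gcd_comm]
  have h4 : w i * w j * w k ≤ K ^ 3 * lcmW w := by
    calc w i * w j * w k = Nat.gcd (w i) (w j) * (Nat.lcm (w i) (w j) * w k) := by
          rw [← h1]; ring
      _ = Nat.gcd (w i) (w j) * (Nat.gcd (Nat.lcm (w i) (w j)) (w k) *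
            Nat.lcm (Nat.lcm (w i) (w j)) (w k)) := by rw [h2]
      _ ≤ K * ((K * K) * lcmW w) := by gcongr
      _ = _ := by ring
  calc M ^ 3 = M * M * M := by ring
    _ ≤ (w i * K) * (w j * K) * (w k * K) := by gcongr
    _ = K ^ 3 * (w i * w j * w k) := by ring
    _ ≤ K ^ 3 * (K ^ 3 * lcmW w) := by gcongr
    _ = _ := by ring

lemma card_box (n M : ℕ) (T : Finset (Fin n)) (A : Finset ℕ) (x : ℝ)
    (hA : (A.card : ℝ) ≤ M * x) :
    ((Fintype.piFinset fun k : Fin n => if k ∈ T then A else Finset.Icc 1 M).card : ℝ)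
      ≤ (M : ℝ) ^ n * x ^ T.card := by
  rw [Fintype.card_piFinset]
  push_cast
  calc ∏ k : Fin n, (((if k ∈ T then A else Finset.Icc 1 M).card : ℕ) : ℝ)
      ≤ ∏ k : Fin n, ((M : ℝ) * (if k ∈ T then x else 1)) := by
        apply Finset.prod_le_prod
        · intros; positivity
        · intro k _
          split_ifs
          · exact hA
          · simp
    _ = _ := by
        rw [Finset.prod_mul_distrib, Finset.prod_ite_mem]
        simp

lemma card_small (n M K : ℕ) (hK : 0 < K) (i : Fin n) :
    (((Fintype.piFinset fun _ : Fin n => Finset.Icc 1 M).filter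
      (fun w => w i * K < M)).card : ℝ) ≤ (M : ℝ) ^ n / K := by
  have hsub : (Fintype.piFinset fun _ : Fin n => Finset.Icc 1 M).filter (fun w => w i * K < M) ⊆
      Fintype.piFinset fun k : Fin n =>
        if k ∈ ({i} : Finset (Fin n)) then Finset.Icc 1 (M / K) else Finset.Icc 1 M := by
    intro w hw
    simp only [Finset.mem_filter, Fintype.mem_piFinset, Finset.mem_Icc] at hw
    rw [Fintype.mem_piFinset]
    intro k
    by_cases hk : k = i
    · subst hk
      simp only [Finset.mem_singleton, if_true, Finset.mem_Icc]
      exact ⟨(hw.1 k).1, (Nat.le_div_iff_mul_le hK).2 hw.2.le⟩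
    · simpa [hk] using hw.1 k
  have h1 := card_box n M {i} (Finset.Icc 1 (M / K)) (1 / K) (by
    rw [Nat.card_Icc, Nat.add_sub_cancel, mul_one_div]
    exact Nat.cast_div_le)
  refine (Nat.cast_le.2 (Finset.card_le_card hsub)).trans (h1.trans (le_of_eq ?_))
  simp [div_eq_mul_inv]

lemma sum_inv_sq (K M : ℕ) (hK : 0 < K) :
    ∑ g ∈ Finset.Ioc K (K + M), (1 / (g : ℝ)) ^ 2 ≤ 1 / K - 1 / ((K + M : ℕ) : ℝ) := by
  induction M with
  | zero => simp
  | succ m ih =>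
    rw [← add_assoc, Finset.sum_Ioc_succ_top (by omega)]
    have hp : (0 : ℝ) < ((K + m : ℕ) : ℝ) := by exact_mod_cast (by omega)
    have : (1 / ((K + m + 1 : ℕ) : ℝ)) ^ 2 ≤ 1 / ((K + m : ℕ) : ℝ) - 1 / ((K + m + 1 : ℕ) : ℝ) := by
      rw [Nat.cast_succ]
      generalize ((K + m : ℕ) : ℝ) = t at hp
      rw [div_sub_div _ _ hp.ne' (by positivity), div_pow, div_le_div_iff₀ (by positivity) (by positivity)]
      nlinarith
    linarith

lemma card_gcd (n M K : ℕ) (hK : 0 < K) (i j : Fin n) (hij : i ≠ j) :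
    (((Fintype.piFinset fun _ : Fin n => Finset.Icc 1 M).filter
      (fun w => K < Nat.gcd (w i) (w j))).card : ℝ) ≤ (M : ℝ) ^ n / K := by
  have hsub : (Fintype.piFinset fun _ : Fin n => Finset.Icc 1 M).filter
      (fun w => K < Nat.gcd (w i) (w j)) ⊆
      (Finset.Ioc K (K + M)).biUnion fun g => Fintype.piFinset fun k : Fin n =>
        if k ∈ ({i, j} : Finset (Fin n)) then (Finset.Ioc 0 M).filter (fun a => g ∣ a)
        else Finset.Icc 1 M := by
    intro w hw
    simp only [Finset.mem_filter, Fintype.mem_piFinset, Finset.mem_Icc] at hw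
    rw [Finset.mem_biUnion]
    refine ⟨Nat.gcd (w i) (w j), ?_, ?_⟩
    · rw [Finset.mem_Ioc]
      have := Nat.gcd_le_left (w j) (hw.1 i).1
      have := (hw.1 i).2
      exact ⟨hw.2, by omega⟩
    · rw [Fintype.mem_piFinset]
      intro k
      have hk1 := hw.1 k
      split_ifs with hk
      · rw [Finset.mem_filter, Finset.mem_Ioc]
        refine ⟨⟨hk1.1, hk1.2⟩, ?_⟩
        rw [Finset.mem_insert, Finset.mem_singleton] at hk
        rcases hk with rfl | rfl
        · exact Nat.gcd_dvd_left _ _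
        · exact Nat.gcd_dvd_right _ _
      · exact Finset.mem_Icc.2 hk1
  calc _ ≤ (((Finset.Ioc K (K + M)).biUnion fun g => Fintype.piFinset fun k : Fin n =>
        if k ∈ ({i, j} : Finset (Fin n)) then (Finset.Ioc 0 M).filter (fun a => g ∣ a)
        else Finset.Icc 1 M).card : ℝ) := Nat.cast_le.2 (Finset.card_le_card hsub)
    _ ≤ ∑ g ∈ Finset.Ioc K (K + M), ((Fintype.piFinset fun k : Fin n =>
        if k ∈ ({i, j} : Finset (Fin n)) then (Finset.Ioc 0 M).filter (fun a => g ∣ a)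
        else Finset.Icc 1 M).card : ℝ) := by exact_mod_cast Finset.card_biUnion_le
    _ ≤ ∑ g ∈ Finset.Ioc K (K + M), (M : ℝ) ^ n * (1 / (g : ℝ)) ^ 2 := by
        apply Finset.sum_le_sum
        intro g _
        have := card_box n M {i, j} ((Finset.Ioc 0 M).filter (fun a => g ∣ a)) (1 / g) (by
          rw [Nat.Ioc_filter_dvd_card_eq_div, mul_one_div]
          exact Nat.cast_div_le)
        rwa [Finset.card_pair hij] at this
    _ ≤ (M : ℝ) ^ n * (1 / K) := by
        rw [← Finset.mul_sum]
        have := sum_inv_sq K M hK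
        have h2 : (0 : ℝ) ≤ 1 / ((K + M : ℕ) : ℝ) := by positivity
        gcongr
        linarith
    _ = _ := by ring

lemma pNoBubble_le_one (n M : ℕ) : pNoBubble n M ≤ 1 := by
  unfold pNoBubble
  apply div_le_one_of_le₀ _ (by positivity)
  calc _ ≤ ((Fintype.piFinset fun _ : Fin n => Finset.Icc 1 M).card : ℝ) :=
        Nat.cast_le.2 (Finset.card_le_card (Finset.filter_subset _ _))
    _ = _ := by simp

lemma pNoBubble_ge (n M K : ℕ) (hn : 3 ≤ n) (hK : 0 < K) (hM : 5 * n * K ^ 6 ≤ M) :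
    1 - 6 / (K : ℝ) ≤ pNoBubble n M := by
  have hMpos : 0 < M := lt_of_lt_of_le (by positivity) hM
  set B := Fintype.piFinset fun _ : Fin n => Finset.Icc 1 M with hB
  let i : Fin n := ⟨0, by omega⟩
  let j : Fin n := ⟨1, by omega⟩
  let k : Fin n := ⟨2, by omega⟩
  have hij : i ≠ j := by simp [i, j]
  have hik : i ≠ k := by simp [i, k]
  have hjk : j ≠ k := by simp [j, k]
  have hcover : B ⊆ B.filter (fun w : Fin n → ℕ => ¬ ∃ u : Fin n → ℕ, IsBubble w u) ∪
      (B.filter (fun w => w i * K < M) ∪ (B.filter (fun w => w j * K < M) ∪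
      (B.filter (fun w => w k * K < M) ∪ (B.filter (fun w => K < Nat.gcd (w i) (w j)) ∪
      (B.filter (fun w => K < Nat.gcd (w i) (w k)) ∪
        B.filter (fun w => K < Nat.gcd (w j) (w k))))))) := by
    intro w hw
    by_contra hc
    simp only [Finset.mem_union, Finset.mem_filter, hw, true_and, not_or, not_lt] at hc
    obtain ⟨h0, h1, h2, h3, h4, h5, h6⟩ := hc
    apply h0
    rintro ⟨u, hu⟩
    rw [hB, Fintype.mem_piFinset] at hw
    have hw' : ∀ l, 0 < w l ∧ w l ≤ M := fun l => Finset.mem_Icc.1 (hw l)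
    refine no_bubble_large (by omega) w u M hw' ?_ hu
    have := lcm_three w (fun l => (hw' l).1) i j k M K h1 h2 h3 h4 h5 h6
    have hK6 : 0 < K ^ 6 := by positivity
    apply Nat.le_of_mul_le_mul_left _ hK6
    calc K ^ 6 * (5 * n * M ^ 2) = (5 * n * K ^ 6) * M ^ 2 := by ring
      _ ≤ M * M ^ 2 := by gcongr
      _ = M ^ 3 := by ring
      _ ≤ _ := this
  have hcard := Finset.card_le_card hcover
  have hBc : B.card = M ^ n := by simp [hB]
  have c1 := card_small n M K hK i
  have c2 := card_small n M K hK j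
  have c3 := card_small n M K hK k
  have c4 := card_gcd n M K hK i j hij
  have c5 := card_gcd n M K hK i k hik
  have c6 := card_gcd n M K hK j k hjk
  rw [← hB] at c1 c2 c3 c4 c5 c6
  have hcard2 : (M : ℝ) ^ n ≤
      ((B.filter (fun w : Fin n → ℕ => ¬ ∃ u : Fin n → ℕ, IsBubble w u)).card : ℝ) +
      (((B.filter (fun w => w i * K < M)).card : ℝ) + (((B.filter (fun w => w j * K < M)).card : ℝ) +
      (((B.filter (fun w => w k * K < M)).card : ℝ) +
      (((B.filter (fun w => K < Nat.gcd (w i) (w j))).card : ℝ) +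
      (((B.filter (fun w => K < Nat.gcd (w i) (w k))).card : ℝ) +
        ((B.filter (fun w => K < Nat.gcd (w j) (w k))).card : ℝ)))))) := by
    rw [hBc] at hcard
    have := hcard.trans ((Finset.card_union_le _ _).trans (Nat.add_le_add_left
      ((Finset.card_union_le _ _).trans (Nat.add_le_add_left
      ((Finset.card_union_le _ _).trans (Nat.add_le_add_left
      ((Finset.card_union_le _ _).trans (Nat.add_le_add_left
      ((Finset.card_union_le _ _).trans (Nat.add_le_add_left
      (Finset.card_union_le _ _) _)) _)) _)) _)) _))
    exact_mod_cast this
  unfold pNoBubble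
  rw [← hB, le_div_iff₀ (by positivity)]
  have : (1 - 6 / (K : ℝ)) * (M : ℝ) ^ n = (M : ℝ) ^ n - 6 * ((M : ℝ) ^ n / K) := by ring
  rw [this]
  linarith

theorem tendsto_pNoBubble (n : ℕ) (hn : 0 < n) :
    Filter.Tendsto (fun M : ℕ => pNoBubble n M) Filter.atTop (nhds 1) := by
  by_cases h3 : 3 ≤ n
  · rw [Metric.tendsto_atTop]
    intro ε hε
    obtain ⟨K, hK⟩ := exists_nat_gt (6 / ε)
    have hKpos : (0 : ℝ) < K := lt_trans (by positivity) hK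
    have hKp : 0 < K := by exact_mod_cast hKpos
    refine ⟨5 * n * K ^ 6, fun M hM => ?_⟩
    have h1 := pNoBubble_ge n M K h3 hKp hM
    have h2 := pNoBubble_le_one n M
    have h4 : 6 / (K : ℝ) < ε := by
      rw [div_lt_iff₀ hKpos]
      rw [div_lt_iff₀ hε] at hK
      linarith
    rw [Real.dist_eq, abs_lt]
    constructor <;> linarith
  · apply tendsto_const_nhds.congr'
    filter_upwards [Filter.eventually_gt_atTop 0] with M hM
    unfold pNoBubble
    rw [Finset.filter_true_of_mem]
    · have : (M : ℝ) ≠ 0 := by positivity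
      simp [this]
    · rintro w _ ⟨u, hu⟩
      exact no_bubble_small hn (by omega) w u hu
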